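/- (Proposition 3, case D=3) Let T_{ij} be a smooth symmetric tensor field on ℝ³ satisfying ∂_j T_{ij}=0 for all i. Then there exists a smooth symmetric tensor field R_{ij} on ℝ³, with trace R = δ^{ij}R_{ij}, such that T_{ij} = ΔR_{ij} − 2 ∂_k∂_{(i}R_{j)k} + (1/2) ∂_i∂_j R + ( ∂_k∂_p R_{kp} − (1/2) ΔR ) δ_{ij} (sums over k,p), i.e. formula (16c) with a=1, b=1/2. -/

import Mathlib

/-- Partial derivative in the k-th Cartesian coordinate direction on ℝ^D. -/
noncomputable def pd {D : ℕ} (k : Fin D) (f : (Fin D → ℝ) → ℝ) : (Fin D → ℝ) → ℝ :=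
  fun x => fderiv ℝ f x (Pi.single k 1)

/-- Euclidean Laplacian Σ_k ∂_k∂_k. -/
noncomputable def lap {D : ℕ} (f : (Fin D → ℝ) → ℝ) : (Fin D → ℝ) → ℝ :=
  fun x => ∑ k, pd k (pd k f) x

/-- Formula (16c): T_{ij} = a ΔR_{ij} − 2a ∂_k∂_{(i}R_{j)k} + b ∂_i∂_j R
    + (a ∂_k∂_p R_{kp} − b ΔR) δ_{ij}, where R = δ^{ij} R_{ij}. -/
noncomputable def Tform {D : ℕ} (a b : ℝ) (Rt : Fin D → Fin D → (Fin D → ℝ) → ℝ)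
    (i j : Fin D) : (Fin D → ℝ) → ℝ :=
  fun x =>
    a * lap (Rt i j) x
    - 2 * a * ((1/2 : ℝ) * ((∑ k, pd k (pd i (Rt j k)) x) + (∑ k, pd k (pd j (Rt i k)) x)))
    + b * pd i (pd j (fun y => ∑ m, Rt m m y)) x
    + (a * (∑ k, ∑ p, pd k (pd p (Rt k p)) x) - b * lap (fun y => ∑ m, Rt m m y) x)
      * (if i = j then (1 : ℝ) else 0)

open scoped ContDiff
open MeasureTheory Set

section ParametricIntegral

variable {E F : Type} [NormedAddCommGroup E] [NormedSpace ℝ E] [FiniteDimensional ℝ E]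
  [NormedAddCommGroup F] [NormedSpace ℝ F]

theorem hasFDerivAt_intervalIntegral_of_contDiff {f : E → ℝ → F} (hf : ContDiff ℝ 1 ↿f)
    (a b : ℝ) (x₀ : E) :
    HasFDerivAt (fun x => ∫ t in a..b, f x t)
      (∫ t in a..b, fderiv ℝ (fun x => f x t) x₀) x₀ := by
  have hd : Continuous fun p : E × ℝ => fderiv ℝ (fun x => f x p.2) p.1 :=
    (ContDiff.fderiv (f := fun (p : E × ℝ) x => f x p.2) (n := 0) (m := 1)
      (hf.comp (by fun_prop : ContDiff ℝ 1 fun q : (E × ℝ) × E => (q.2, q.1.2)))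
      contDiff_fst (zero_add 1).le).continuous
  have hc : Continuous ↿f := hf.continuous
  have hcx (x : E) : Continuous (f x) := hc.comp (by fun_prop : Continuous fun t : ℝ => (x, t))
  have hdx (x : E) : Continuous fun t => fderiv ℝ (fun x => f x t) x :=
    hd.comp (by fun_prop : Continuous fun t : ℝ => (x, t))
  have : ProperSpace E := FiniteDimensional.proper ℝ E
  obtain ⟨M, hM⟩ := ((isCompact_closedBall x₀ 1).prod (isCompact_uIcc (a := a) (b := b))
    ).exists_bound_of_continuousOn hd.continuousOn
  refine intervalIntegral.hasFDerivAt_integral_of_dominated_of_fderiv_le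
    (F := f) (F' := fun x t => fderiv ℝ (fun x => f x t) x) (bound := fun _ => M)
    (Metric.closedBall_mem_nhds x₀ one_pos) ?_ ?_ ?_ ?_ ?_ ?_
  · exact .of_forall fun x => (hcx x).aestronglyMeasurable
  · exact (hcx x₀).intervalIntegrable _ _
  · exact (hdx x₀).aestronglyMeasurable
  · exact .of_forall fun t ht x hx => hM (x, t) ⟨hx, uIoc_subset_uIcc ht⟩
  · exact intervalIntegrable_const
  · refine .of_forall fun t _ x _ => DifferentiableAt.hasFDerivAt ?_
    exact ((hf.comp (by fun_prop : ContDiff ℝ 1 fun x : E => (x, t))).differentiable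
      one_ne_zero).differentiableAt

end ParametricIntegral

theorem contDiff_intervalIntegral_nat {E : Type} [NormedAddCommGroup E] [NormedSpace ℝ E]
    [FiniteDimensional ℝ E] (n : ℕ) {F : Type} [NormedAddCommGroup F] [NormedSpace ℝ F]
    {f : E → ℝ → F} (hf : ContDiff ℝ n ↿f) (a b : ℝ) :
    ContDiff ℝ n fun x => ∫ t in a..b, f x t := by
  induction n generalizing F with
  | zero =>
    exact contDiff_zero.2 (intervalIntegral.continuous_parametric_intervalIntegral_of_continuous'
      (contDiff_zero.1 hf) a b)
  | succ n ih =>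
    have hderiv := hasFDerivAt_intervalIntegral_of_contDiff
      (hf.of_le (by exact_mod_cast Nat.le_add_left 1 n)) a b
    push_cast at hf ⊢
    rw [contDiff_succ_iff_fderiv]
    refine ⟨fun x => (hderiv x).differentiableAt, by simp, ?_⟩
    rw [funext fun x => (hderiv x).fderiv]
    exact ih (ContDiff.fderiv (f := fun (p : E × ℝ) x => f x p.2)
      (hf.comp (by fun_prop : ContDiff ℝ (n + 1) fun q : (E × ℝ) × E => (q.2, q.1.2)))
      contDiff_fst le_rfl)

theorem contDiff_intervalIntegral {E : Type} [NormedAddCommGroup E] [NormedSpace ℝ E]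
    [FiniteDimensional ℝ E] {F : Type} [NormedAddCommGroup F] [NormedSpace ℝ F]
    {f : E → ℝ → F} (hf : ContDiff ℝ ∞ ↿f) (a b : ℝ) :
    ContDiff ℝ ∞ fun x => ∫ t in a..b, f x t :=
  contDiff_infty.2 fun n => contDiff_intervalIntegral_nat n (contDiff_infty.1 hf n) a b

section PartialDerivative

variable {D : ℕ}

theorem contDiff_pd (k : Fin D) {f : (Fin D → ℝ) → ℝ} (hf : ContDiff ℝ ∞ f) :
    ContDiff ℝ ∞ (pd k f) :=
  (hf.fderiv_right (m := ∞) le_rfl).clm_apply contDiff_const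

theorem pd_comm (j k : Fin D) {f : (Fin D → ℝ) → ℝ} (hf : ContDiff ℝ ∞ f) :
    pd j (pd k f) = pd k (pd j f) := by
  have hd : Differentiable ℝ (fderiv ℝ f) :=
    (hf.fderiv_right (m := ∞) le_rfl).differentiable (by simp)
  have key (j k : Fin D) (x : Fin D → ℝ) :
      pd j (pd k f) x = fderiv ℝ (fderiv ℝ f) x (Pi.single j 1) (Pi.single k 1) := by
    unfold pd
    rw [fderiv_clm_apply (hd x) (differentiableAt_const _)]
    simp
  funext x
  rw [key, key]
  refine (hf.contDiffAt.isSymmSndFDerivAt ?_).eq _ _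
  rw [minSmoothness_of_isRCLikeNormedField]
  exact WithTop.coe_le_coe.2 (le_top : (2 : ℕ∞) ≤ ⊤)

/-- The algebra of smooth functions on `ℝ^D`. -/
def smoothAlg (D : ℕ) : Subalgebra ℝ ((Fin D → ℝ) → ℝ) where
  carrier := {f | ContDiff ℝ ∞ f}
  mul_mem' {f g} (hf : ContDiff ℝ ∞ f) (hg : ContDiff ℝ ∞ g) := hf.mul hg
  add_mem' {f g} (hf : ContDiff ℝ ∞ f) (hg : ContDiff ℝ ∞ g) := hf.add hg
  algebraMap_mem' c := (contDiff_const : ContDiff ℝ ∞ fun _ : Fin D → ℝ => c)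

/-- The partial derivative as a linear operator on smooth functions. -/
noncomputable def pdₗ (k : Fin D) : smoothAlg D →ₗ[ℝ] smoothAlg D where
  toFun f := ⟨pd k f, contDiff_pd k f.2⟩
  map_add' f g := by
    ext x
    have hf : Differentiable ℝ f.1 :=
      ContDiff.differentiable (n := ∞) f.2 (by simp)
    have hg : Differentiable ℝ g.1 :=
      ContDiff.differentiable (n := ∞) g.2 (by simp)
    simp [pd, fderiv_add (hf x) (hg x)]
  map_smul' c f := by
    ext x
    have hf : Differentiable ℝ f.1 :=
      ContDiff.differentiable (n := ∞) f.2 (by simp)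
    simp [pd, fderiv_const_smul (hf x) c]

theorem coe_pdₗ (k : Fin D) (f : smoothAlg D) : (pdₗ k f : (Fin D → ℝ) → ℝ) = pd k f := rfl

theorem pdₗ_comm (j k : Fin D) (f : smoothAlg D) : pdₗ j (pdₗ k f) = pdₗ k (pdₗ j f) :=
  Subtype.ext (pd_comm j k f.2)

theorem hasDerivAt_update_of_contDiff (k : Fin D) {f : (Fin D → ℝ) → ℝ} (hf : ContDiff ℝ ∞ f)
    (x : Fin D → ℝ) (s : ℝ) :
    HasDerivAt (fun s => f (Function.update x k s)) (pd k f (Function.update x k s)) s :=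
  ((hf.differentiable (by simp)) _).hasFDerivAt.comp_hasDerivAt s (hasDerivAt_update x k s)

theorem pd_eq_of_hasDerivAt_update (k : Fin D) {f : (Fin D → ℝ) → ℝ} (hf : ContDiff ℝ ∞ f)
    {x : Fin D → ℝ} {c : ℝ} (h : HasDerivAt (fun s => f (Function.update x k s)) c (x k)) :
    pd k f x = c := by
  have h' := hasDerivAt_update_of_contDiff k hf x (x k)
  rw [Function.update_eq_self] at h'
  exact h'.unique h

theorem exists_pdₗ_eq (k : Fin D) (f : smoothAlg D) : ∃ g, pdₗ k g = f := by
  have hf : ContDiff ℝ ∞ f.1 := f.2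
  have hu : ContDiff ℝ ∞ ↿fun (x : Fin D → ℝ) (t : ℝ) =>
      f.1 (Function.update x k (t * x k)) := by
    refine hf.comp (contDiff_pi.2 fun i => ?_)
    by_cases h : i = k
    · subst h
      simp only [Function.update_self]
      fun_prop
    · simp only [Function.update_of_ne h]
      fun_prop
  have hg : ContDiff ℝ ∞ fun x : Fin D → ℝ =>
      x k * ∫ t in (0 : ℝ)..1, f.1 (Function.update x k (t * x k)) :=
    (contDiff_apply ℝ ℝ k).mul (contDiff_intervalIntegral hu 0 1)
  refine ⟨⟨_, hg⟩, Subtype.ext (funext fun x => pd_eq_of_hasDerivAt_update k hg ?_)⟩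
  have hc : Continuous fun s => f.1 (Function.update x k s) :=
    hf.continuous.comp (continuous_const.update k continuous_id)
  have h := intervalIntegral.integral_hasDerivAt_right (hc.intervalIntegrable 0 (x k))
    (hc.stronglyMeasurableAtFilter _ _) hc.continuousAt
  rw [Function.update_eq_self] at h
  refine h.congr_of_eventuallyEq (.of_forall fun s => ?_)
  simp only [Function.update_self, Function.update_idem]
  rw [← smul_eq_mul,
    intervalIntegral.smul_integral_comp_mul_right (fun s => f.1 (Function.update x k s))]
  simp

theorem exists_pdₗ_eq_of_pdₗ_eq_zero {j k : Fin D} (hjk : j ≠ k) {f : smoothAlg D}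
    (hf : pdₗ k f = 0) : ∃ g, pdₗ j g = f ∧ pdₗ k g = 0 := by
  obtain ⟨h, hh⟩ := exists_pdₗ_eq j f
  have hg : ContDiff ℝ ∞ fun x : Fin D → ℝ => h.1 (Function.update x k 0) := by
    refine ContDiff.comp (g := h.1) h.2 (contDiff_pi.2 fun i => ?_)
    by_cases h : i = k
    · subst h
      simp only [Function.update_self]
      fun_prop
    · simp only [Function.update_of_ne h]
      fun_prop
  refine ⟨⟨_, hg⟩, Subtype.ext (funext fun x => pd_eq_of_hasDerivAt_update j hg ?_),
    Subtype.ext (funext fun x => pd_eq_of_hasDerivAt_update k hg ?_)⟩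
  · have h1 := hasDerivAt_update_of_contDiff j h.2 (Function.update x k 0) (x j)
    have h2 : Function.update (Function.update x k 0) j (x j) = Function.update x k 0 := by
      rw [Function.update_comm hjk.symm, Function.update_eq_self]
    have h3 : f.1 (Function.update x k 0) = f.1 x := by
      have hz (s : ℝ) : HasDerivAt (fun s => f.1 (Function.update x k s)) 0 s := by
        have := hasDerivAt_update_of_contDiff k f.2 x s
        rwa [← coe_pdₗ, hf] at this
      have := is_const_of_deriv_eq_zero (fun s => (hz s).differentiableAt)
        (fun s => (hz s).deriv) 0 (x k)
      simpa using this
    rw [h2, ← coe_pdₗ, hh, h3] at h1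
    simpa only [Function.update_comm hjk] using h1
  · simp only [Function.update_idem]
    exact hasDerivAt_const (x k) _

end PartialDerivative

/-- A smooth divergence-free vector field on `ℝ³` is the curl of a smooth vector field. -/
theorem exists_curl_eq (V : Fin 3 → smoothAlg 3) (hV : ∑ i, pdₗ i (V i) = 0) :
    ∃ A : Fin 3 → smoothAlg 3, V 0 = pdₗ 1 (A 2) - pdₗ 2 (A 1) ∧
      V 1 = pdₗ 2 (A 0) - pdₗ 0 (A 2) ∧ V 2 = pdₗ 0 (A 1) - pdₗ 1 (A 0) := by
  obtain ⟨a, ha⟩ := exists_pdₗ_eq 2 (V 1)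
  obtain ⟨b, hb⟩ := exists_pdₗ_eq 2 (V 0)
  obtain ⟨c, hc, hc'⟩ := exists_pdₗ_eq_of_pdₗ_eq_zero (j := 0) (k := 2) (by decide)
    (f := V 2 + pdₗ 0 b + pdₗ 1 a) (by
      rw [map_add, map_add, pdₗ_comm 2 0, pdₗ_comm 2 1, ha, hb, ← hV, Fin.sum_univ_three]
      abel)
  refine ⟨![a, c - b, 0], ?_, ?_, ?_⟩
  · simp [hc', hb]
  · simp [ha]
  · simp only [Matrix.cons_val, map_sub, hc]
    abel

/-- The symmetric part of the double curl of `C`, written through the trace-reversed potential. -/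
theorem double_curl_identity {M : Type*} [AddCommGroup M] [Module ℝ M] (D : Fin 3 → M →ₗ[ℝ] M)
    (hD : ∀ i j f, D i (D j f) = D j (D i f)) {T A C R : Fin 3 → Fin 3 → M}
    (hsym : ∀ i j, T i j = T j i)
    (hA0 : ∀ i, T i 0 = D 1 (A i 2) - D 2 (A i 1))
    (hA1 : ∀ i, T i 1 = D 2 (A i 0) - D 0 (A i 2))
    (hA2 : ∀ i, T i 2 = D 0 (A i 1) - D 1 (A i 0))
    (hC0 : ∀ m, (if m = 0 then ∑ k, A k k else 0) - A 0 m = D 1 (C m 2) - D 2 (C m 1))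
    (hC1 : ∀ m, (if m = 1 then ∑ k, A k k else 0) - A 1 m = D 2 (C m 0) - D 0 (C m 2))
    (hC2 : ∀ m, (if m = 2 then ∑ k, A k k else 0) - A 2 m = D 0 (C m 1) - D 1 (C m 0))
    (hR : ∀ i j, R i j = (1 / 2 : ℝ) • (C i j + C j i) - if i = j then ∑ k, C k k else 0)
    (i j : Fin 3) :
    T i j = ∑ k, D k (D k (R i j))
      - (∑ k, D k (D i (R j k)) + ∑ k, D k (D j (R i k)))
      + (1 / 2 : ℝ) • D i (D j (∑ m, R m m))
      + (if i = j then (1 : ℝ) else 0) • (∑ k, ∑ p, D k (D p (R k p))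
        - (1 / 2 : ℝ) • ∑ k, D k (D k (∑ m, R m m))) := by
  have A00 : A 0 0 = (1 / 2 : ℝ) • (D 2 (C 1 0) - D 0 (C 1 2) + D 0 (C 2 1) - D 1 (C 2 0)
      - D 1 (C 0 2) + D 2 (C 0 1)) := by
    have h0 := hC0 0
    have h1 := hC1 1
    have h2 := hC2 2
    simp only [if_true, Fin.sum_univ_three] at h0 h1 h2
    linear_combination (norm := module) (1 / 2 : ℝ) • (h1 + h2 - h0)
  have A11 : A 1 1 = (1 / 2 : ℝ) • (D 0 (C 2 1) - D 1 (C 2 0) + D 1 (C 0 2) - D 2 (C 0 1)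
      - D 2 (C 1 0) + D 0 (C 1 2)) := by
    have h0 := hC0 0
    have h1 := hC1 1
    have h2 := hC2 2
    simp only [if_true, Fin.sum_univ_three] at h0 h1 h2
    linear_combination (norm := module) (1 / 2 : ℝ) • (h0 + h2 - h1)
  have A22 : A 2 2 = (1 / 2 : ℝ) • (D 1 (C 0 2) - D 2 (C 0 1) + D 2 (C 1 0) - D 0 (C 1 2)
      - D 0 (C 2 1) + D 1 (C 2 0)) := by
    have h0 := hC0 0
    have h1 := hC1 1
    have h2 := hC2 2
    simp only [if_true, Fin.sum_univ_three] at h0 h1 h2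
    linear_combination (norm := module) (1 / 2 : ℝ) • (h0 + h1 - h2)
  have A0 (m : Fin 3) (hm : m ≠ 0) : A 0 m = D 2 (C m 1) - D 1 (C m 2) := by
    have := hC0 m
    rw [if_neg hm] at this
    linear_combination (norm := module) -this
  have A1 (m : Fin 3) (hm : m ≠ 1) : A 1 m = D 0 (C m 2) - D 2 (C m 0) := by
    have := hC1 m
    rw [if_neg hm] at this
    linear_combination (norm := module) -this
  have A2 (m : Fin 3) (hm : m ≠ 2) : A 2 m = D 1 (C m 0) - D 0 (C m 1) := by
    have := hC2 m
    rw [if_neg hm] at this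
    linear_combination (norm := module) -this
  trans (1 / 2 : ℝ) • (T i j + T j i)
  · rw [hsym j i]
    module
  fin_cases i <;> fin_cases j <;>
    simp [hR, Fin.sum_univ_three, hA0, hA1, hA2, A00, A11, A22, A0, A1, A2, hD 1 0, hD 2 0,
      hD 2 1] <;>
    module

/-- A smooth symmetric divergence-free tensor field on `ℝ³` is minus the incompatibility
(double curl) of a smooth tensor field. -/
theorem exists_double_curl_eq (T : Fin 3 → Fin 3 → smoothAlg 3) (hsym : ∀ i j, T i j = T j i)
    (hdiv : ∀ i, ∑ j, pdₗ j (T i j) = 0) :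
    ∃ R : Fin 3 → Fin 3 → smoothAlg 3, (∀ i j, R i j = R j i) ∧ ∀ i j,
      T i j = ∑ k, pdₗ k (pdₗ k (R i j))
        - (∑ k, pdₗ k (pdₗ i (R j k)) + ∑ k, pdₗ k (pdₗ j (R i k)))
        + (1 / 2 : ℝ) • pdₗ i (pdₗ j (∑ m, R m m))
        + (if i = j then (1 : ℝ) else 0) • (∑ k, ∑ p, pdₗ k (pdₗ p (R k p))
          - (1 / 2 : ℝ) • ∑ k, pdₗ k (pdₗ k (∑ m, R m m))) := by
  choose A hA0 hA1 hA2 using fun i => exists_curl_eq (T i) (hdiv i)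
  have h01 := hsym 0 1
  have h02 := hsym 0 2
  have h12 := hsym 1 2
  rw [hA0, hA1] at h01
  rw [hA0, hA2] at h02
  rw [hA1, hA2] at h12
  choose C hC0 hC1 hC2 using fun m => exists_curl_eq
    (fun i => (if m = i then ∑ k, A k k else 0) - A i m) (by
      fin_cases m <;> simp [Fin.sum_univ_three]
      · linear_combination h12
      · linear_combination -h02
      · linear_combination h01)
  exact ⟨_, fun i j => by simp only [add_comm, eq_comm],
    double_curl_identity pdₗ pdₗ_comm hsym hA0 hA1 hA2 hC0 hC1 hC2 fun _ _ => rfl⟩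

/-- Proposition 3, case D = 3: every smooth symmetric transverse tensor
field on ℝ³ arises from some smooth symmetric R_{ij} via formula (16c) with a = 1,
b = 1/2. -/
theorem stmt_7
    (T : Fin 3 → Fin 3 → (Fin 3 → ℝ) → ℝ)
    (hsmooth : ∀ i j, ContDiff ℝ (⊤ : ℕ∞) (T i j))
    (hsym : ∀ i j x, T i j x = T j i x)
    (htrans : ∀ i x, ∑ j, pd j (T i j) x = 0) :
    ∃ Rt : Fin 3 → Fin 3 → (Fin 3 → ℝ) → ℝ,
      (∀ i j, ContDiff ℝ (⊤ : ℕ∞) (Rt i j)) ∧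
      (∀ i j x, Rt i j x = Rt j i x) ∧
      (∀ i j x, T i j x = Tform 1 (1/2 : ℝ) Rt i j x) := by
  obtain ⟨R, hR, hTR⟩ := exists_double_curl_eq (fun i j => ⟨T i j, hsmooth i j⟩)
    (fun i j => Subtype.ext (funext (hsym i j)))
    (fun i => Subtype.ext (funext fun x => by simpa [coe_pdₗ] using htrans i x))
  refine ⟨fun i j => R i j, fun i j => (R i j).2,
    fun i j x => congrArg (fun f : smoothAlg 3 => f.1 x) (hR i j), fun i j x => ?_⟩
  have htr : (fun y => ∑ m, (R m m : (Fin 3 → ℝ) → ℝ) y) = (∑ m, R m m : smoothAlg 3) := by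
    ext y
    simp
  have h := congrFun (congrArg Subtype.val (hTR i j)) x
  simp only [Tform, lap, htr, ← coe_pdₗ]
  refine h.trans ?_
  split_ifs <;> simp
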